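/- arXiv:1706.02643 — 2 statements merged into one kernel-verified Lean document; each statement's English description precedes it below -/
import Mathlib

section
/- Let f = (f₁, f₂) : ℝ² → ℝ² be defined by f₁(x,y) = e^x cos y − 1 and f₂(x,y) = e^x sin y, and for k ∈ ℤ let P_k = {(x,y) ∈ ℝ² : e^x < 2 cos y and (4k − 1)π < 2y < (4k + 1)π}. Then P_k = {(x,y) : (e^x cos y − 1)² + (e^x sin y)² < 1 and (4k − 1)π/2 < y < (4k + 1)π/2}, and every point of P_k \ {(0, 2kπ)} lies on a periodic solution of ∇H_f^⊥ whose image is contained in P_k; i.e., P_k is the period annulus of the center (0, 2kπ). -/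
open Real Set

/-- Partial derivative in the `x` direction. -/
noncomputable def pdx (g : ℝ × ℝ → ℝ) (z : ℝ × ℝ) : ℝ := fderiv ℝ g z (1, 0)

/-- Partial derivative in the `y` direction. -/
noncomputable def pdy (g : ℝ × ℝ → ℝ) (z : ℝ × ℝ) : ℝ := fderiv ℝ g z (0, 1)

/-- The Hamiltonian `H_f = (f₁² + f₂²)/2`. -/
noncomputable def Ham (f : ℝ × ℝ → ℝ × ℝ) (z : ℝ × ℝ) : ℝ :=
  ((f z).1 ^ 2 + (f z).2 ^ 2) / 2

/-- The Hamiltonian vector field `∇H_f^⊥ = (−∂H_f/∂y, ∂H_f/∂x)`. -/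
noncomputable def hamVF (f : ℝ × ℝ → ℝ × ℝ) (z : ℝ × ℝ) : ℝ × ℝ :=
  (-(pdy (Ham f) z), pdx (Ham f) z)

/-- The Jacobian determinant `det Df = ∂f₁/∂x ∂f₂/∂y − ∂f₂/∂x ∂f₁/∂y`. -/
noncomputable def jacDet (f : ℝ × ℝ → ℝ × ℝ) (z : ℝ × ℝ) : ℝ :=
  pdx (fun w => (f w).1) z * pdy (fun w => (f w).2) z -
    pdx (fun w => (f w).2) z * pdy (fun w => (f w).1) z

/-- `γ` is a periodic solution of the vector field `X` whose image is contained in `S`: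
a non-constant `C¹` curve solving `γ' = X ∘ γ` with some period `T > 0`. -/
def IsPeriodicSolOn (X : ℝ × ℝ → ℝ × ℝ) (S : Set (ℝ × ℝ)) (γ : ℝ → ℝ × ℝ) : Prop :=
  (∀ t, γ t ∈ S) ∧ (∀ t, HasDerivAt γ (X (γ t)) t) ∧
    (∃ T > 0, ∀ t, γ (t + T) = γ t) ∧ ∃ t s, γ t ≠ γ s

/-- The Euclidean norm on `ℝ²`. -/
noncomputable def euclNorm (w : ℝ × ℝ) : ℝ := Real.sqrt (w.1 ^ 2 + w.2 ^ 2)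

/-- The open Euclidean disc of radius `r` centered at the origin. -/
def disc (r : ℝ) : Set (ℝ × ℝ) := {w | euclNorm w < r}

/-- `W` is the period annulus of the singular point `z₀` of the vector field `X` on `U`:
the maximal open connected subset of `U` containing `z₀` all whose points other than `z₀`
lie on periodic solutions of `X` contained in `W`. -/
def IsPeriodAnnulus (X : ℝ × ℝ → ℝ × ℝ) (U : Set (ℝ × ℝ)) (z₀ : ℝ × ℝ)
    (W : Set (ℝ × ℝ)) : Prop :=
  z₀ ∈ W ∧ W ⊆ U ∧ IsOpen W ∧ IsConnected W ∧
    (∀ z ∈ W \ {z₀}, ∃ γ, IsPeriodicSolOn X W γ ∧ γ 0 = z) ∧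
    ∀ W', z₀ ∈ W' → W' ⊆ U → IsOpen W' → IsConnected W' →
      (∀ z ∈ W' \ {z₀}, ∃ γ, IsPeriodicSolOn X W' γ ∧ γ 0 = z) → W ⊆ W' → W' = W

/-- The plane vector field `∇H_f^⊥` for `f = exp - 1`, in coordinates. -/
theorem hamVF_exp_sub_one (f : ℝ × ℝ → ℝ × ℝ)
    (hf : ∀ x y : ℝ, f (x, y) =
      (Real.exp x * Real.cos y - 1, Real.exp x * Real.sin y)) (z : ℝ × ℝ) :
    hamVF f z = (-(Real.exp z.1 * Real.sin z.2),
      Real.exp z.1 ^ 2 - Real.exp z.1 * Real.cos z.2) := by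
  have hHam : Ham f = fun z : ℝ × ℝ =>
      ((Real.exp z.1 * Real.cos z.2 - 1) ^ 2 + (Real.exp z.1 * Real.sin z.2) ^ 2) * 2⁻¹ := by
    funext ⟨x, y⟩
    simp only [Ham, hf, div_eq_mul_inv]
  have h1 : HasFDerivAt (fun z : ℝ × ℝ => z.1) (ContinuousLinearMap.fst ℝ ℝ ℝ) z :=
    hasFDerivAt_fst
  have h2 : HasFDerivAt (fun z : ℝ × ℝ => z.2) (ContinuousLinearMap.snd ℝ ℝ ℝ) z :=
    hasFDerivAt_snd
  have hd := (((((h1.exp).mul h2.cos).sub_const 1).pow 2).add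
    (((h1.exp).mul h2.sin).pow 2)).mul_const (2⁻¹ : ℝ)
  replace hd := hd.congr_of_eventuallyEq (Filter.EventuallyEq.of_eq hHam)
  have hsq := Real.sin_sq_add_cos_sq z.2
  simp only [hamVF, pdx, pdy, hd.fderiv]
  ext
  · simp
    ring
  · simp
    linear_combination (Real.exp z.1 ^ 2) * hsq

/-- The Hamiltonian of `exp - 1` is a first integral of its Hamiltonian vector field. -/
theorem exp_sq_sub_const_along {γ : ℝ → ℝ × ℝ}
    (hγ : ∀ t, HasDerivAt γ (-(Real.exp (γ t).1 * Real.sin (γ t).2),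
      Real.exp (γ t).1 ^ 2 - Real.exp (γ t).1 * Real.cos (γ t).2) t) (t s : ℝ) :
    Real.exp (γ t).1 ^ 2 - 2 * (Real.exp (γ t).1 * Real.cos (γ t).2) =
      Real.exp (γ s).1 ^ 2 - 2 * (Real.exp (γ s).1 * Real.cos (γ s).2) := by
  have hd : ∀ t, HasDerivAt
      (fun t => Real.exp (γ t).1 ^ 2 - 2 * (Real.exp (γ t).1 * Real.cos (γ t).2)) 0 t := by
    intro t
    have h1 := (hasFDerivAt_fst.comp_hasDerivAt t (hγ t) : HasDerivAt (fun t => (γ t).1) _ t)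
    have h2 := (hasFDerivAt_snd.comp_hasDerivAt t (hγ t) : HasDerivAt (fun t => (γ t).2) _ t)
    refine ((h1.exp.pow 2).sub ((h1.exp.mul h2.cos).const_mul 2)).congr_deriv ?_
    simp
    ring
  exact is_const_of_deriv_eq_zero (fun t => (hd t).differentiableAt) (fun t => (hd t).deriv) t s

/-- No periodic orbit of the Hamiltonian vector field of `exp - 1` lies on the level
through the pole. -/
theorem not_periodic_of_exp_eq {γ : ℝ → ℝ × ℝ}
    (hγ : ∀ t, HasDerivAt γ (-(Real.exp (γ t).1 * Real.sin (γ t).2),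
      Real.exp (γ t).1 ^ 2 - Real.exp (γ t).1 * Real.cos (γ t).2) t)
    (h0 : Real.exp (γ 0).1 = 2 * Real.cos (γ 0).2) {T : ℝ} (hT : 0 < T) : γ (0 + T) ≠ γ 0 := by
  intro hper
  have hmono : StrictMono (fun t => (γ t).2) := by
    apply strictMono_of_deriv_pos
    intro t
    have h2 := (hasFDerivAt_snd.comp_hasDerivAt t (hγ t) : HasDerivAt (fun t => (γ t).2) _ t)
    refine lt_of_lt_of_eq ?_ h2.deriv.symm
    have hc := exp_sq_sub_const_along hγ t 0
    simp only [ContinuousLinearMap.coe_snd']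
    rw [h0] at hc
    nlinarith [Real.exp_pos (γ t).1]
  have := hmono (show (0 : ℝ) < 0 + T by linarith)
  simp only [hper, lt_irrefl] at this

/-- Every orbit of `u' = i |u|² (u - 1)` inside the disc `|u - 1| < 1` is periodic; it is
parametrized by a Möbius transformation of a uniform rotation. -/
theorem exists_periodic_orbit_disc {u : ℂ} (hu : ‖u - 1‖ < 1) :
    ∃ U : ℝ → ℂ, U 0 = u ∧ (∀ t, ‖U t - 1‖ < 1) ∧
      (∀ t, HasDerivAt U (U t * (Complex.I * (starRingEnd ℂ (U t) * (U t - 1)))) t) ∧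
      ∃ T > 0, ∀ t, U (t + T) = U t := by
  have hu0 : u ≠ 0 := by
    rintro rfl
    simp at hu
  set r := ‖u - 1‖ with hr
  set a : ℝ := 1 - r ^ 2 with ha
  have hr0 : 0 ≤ r := norm_nonneg _
  have ha0 : 0 < a := by nlinarith
  set q : ℂ := (u - 1) * starRingEnd ℂ u / u with hq
  have hqn : ‖q‖ = r := by
    rw [hq, norm_div, norm_mul, Complex.norm_conj, mul_div_cancel_right₀ _ (norm_ne_zero_iff.2 hu0)]
  have hr2 : ((r : ℂ)) ^ 2 = (u - 1) * starRingEnd ℂ (u - 1) := by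
    rw [Complex.mul_conj, Complex.normSq_eq_norm_sq]
    push_cast
    rfl
  let Q : ℝ → ℂ := fun t => q * Complex.exp ((a * t : ℝ) * Complex.I)
  have hQn : ∀ t, ‖Q t‖ = r := fun t => by
    simp only [Q, norm_mul, Complex.norm_exp_ofReal_mul_I, mul_one, hqn]
  have hQ2 : ∀ t, (a : ℂ) = 1 - Q t * starRingEnd ℂ (Q t) := fun t => by
    rw [Complex.mul_conj, Complex.normSq_eq_norm_sq, hQn, ha]
    push_cast
    rfl
  have hne : ∀ t, 1 - Q t ≠ 0 := fun t h => by
    have := hQn t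
    rw [← sub_eq_zero.1 h, norm_one] at this
    linarith
  have hne' : ∀ t, 1 - starRingEnd ℂ (Q t) ≠ 0 := fun t h => by
    apply hne t
    have := congrArg (starRingEnd ℂ) h
    simpa using this
  have hsub : ∀ t, a / (1 - Q t) - 1 = Q t * (1 - starRingEnd ℂ (Q t)) / (1 - Q t) := fun t => by
    have := hne t
    field_simp
    rw [hQ2 t]
    ring
  have hQd : ∀ t, HasDerivAt Q (Q t * (a * Complex.I)) t := fun t => by
    have h1 : HasDerivAt (fun t : ℝ => ((a * t : ℝ) : ℂ) * Complex.I) (a * Complex.I) t := by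
      have := (((hasDerivAt_id t).const_mul a).ofReal_comp).mul_const Complex.I
      simpa using this
    refine (h1.cexp.const_mul q).congr_deriv ?_
    simp only [Q]
    ring
  refine ⟨fun t => a / (1 - Q t), ?_, fun t => ?_, fun t => ?_,
    2 * π / a, by positivity, fun t => ?_⟩
  · have h := hne 0
    have hQ0 : Q 0 = q := by simp [Q]
    rw [hQ0] at h
    simp only [hQ0]
    rw [div_eq_iff h, hq, ha]
    push_cast
    rw [hr2, map_sub, map_one]
    field_simp
    ring
  · have h1 : ‖1 - starRingEnd ℂ (Q t)‖ = ‖1 - Q t‖ := by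
      rw [← Complex.norm_conj, map_sub, map_one, Complex.conj_conj]
    rw [hsub, norm_div, norm_mul, h1, mul_div_cancel_right₀ _ (norm_ne_zero_iff.2 (hne t)), hQn]
    exact hu
  · have h := ((hQd t).const_sub 1).inv (hne t) |>.const_mul (a : ℂ)
    refine h.congr_deriv ?_
    have h1 := hne t
    have h2 := hne' t
    rw [hsub, map_div₀, Complex.conj_ofReal, map_sub, map_one]
    field_simp
  · have : Q (t + 2 * π / a) = Q t := by
      simp only [Q]
      rw [mul_add, mul_div_cancel₀ _ ha0.ne']
      push_cast
      rw [add_mul, Complex.exp_add, Complex.exp_two_pi_mul_I, mul_one]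
    simp only [this]

/-- The branch of `log u`, for `Re u > 0`, with imaginary part near `c`. -/
noncomputable def logBranch (c : ℝ) (u : ℂ) : ℝ × ℝ := ((Complex.log u).re, (Complex.log u).im + c)

/-- The strip component `P_k` of `{e^x < 2 cos y}`. -/
def strip (k : ℤ) : Set (ℝ × ℝ) := {z : ℝ × ℝ | Real.exp z.1 < 2 * Real.cos z.2 ∧
  (4 * k - 1) * Real.pi < 2 * z.2 ∧ 2 * z.2 < (4 * k + 1) * Real.pi}

theorem cos_add_two_int_mul_pi (y : ℝ) (k : ℤ) : Real.cos (y + 2 * k * π) = Real.cos y := by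
  rw [← Real.cos_add_int_mul_two_pi y k]
  ring_nf

theorem sin_add_two_int_mul_pi (y : ℝ) (k : ℤ) : Real.sin (y + 2 * k * π) = Real.sin y := by
  rw [← Real.sin_add_int_mul_two_pi y k]
  ring_nf

theorem exp_lt_two_mul_cos_iff (x y : ℝ) : Real.exp x < 2 * Real.cos y ↔
    (Real.exp x * Real.cos y - 1) ^ 2 + (Real.exp x * Real.sin y) ^ 2 < 1 := by
  have h : (Real.exp x * Real.cos y - 1) ^ 2 + (Real.exp x * Real.sin y) ^ 2 - 1 =
      Real.exp x * (Real.exp x - 2 * Real.cos y) := by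
    linear_combination (Real.exp x ^ 2) * Real.sin_sq_add_cos_sq y
  have hx := Real.exp_pos x
  rw [← sub_neg (a := _ + _), h, mul_neg_iff]
  constructor
  · intro h'
    exact Or.inl ⟨hx, by linarith⟩
  · rintro (⟨-, h'⟩ | ⟨h', -⟩) <;> linarith

/-- The coordinates of the logarithm satisfy `e^x cos y = Re u` and `e^x sin y = Im u`. -/
theorem exp_mul_cos_sin_logBranch {u : ℂ} (hu : u ≠ 0) (k : ℤ) :
    Real.exp (logBranch (2 * k * π) u).1 * Real.cos (logBranch (2 * k * π) u).2 = u.re ∧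
    Real.exp (logBranch (2 * k * π) u).1 * Real.sin (logBranch (2 * k * π) u).2 = u.im := by
  simp only [logBranch, cos_add_two_int_mul_pi, sin_add_two_int_mul_pi]
  rw [← Complex.exp_re, ← Complex.exp_im, Complex.exp_log hu]
  exact ⟨rfl, rfl⟩

theorem norm_sub_one_lt_one_iff (u : ℂ) : ‖u - 1‖ < 1 ↔ (u.re - 1) ^ 2 + u.im ^ 2 < 1 := by
  rw [← sq_lt_one_iff₀ (norm_nonneg _), ← Complex.normSq_eq_norm_sq, Complex.normSq_apply]
  simp [sq]

theorem re_pos_of_norm_sub_one_lt {u : ℂ} (hu : ‖u - 1‖ < 1) : 0 < u.re := by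
  have := (Complex.abs_re_le_norm (u - 1)).trans_lt hu
  rw [Complex.sub_re, Complex.one_re, abs_lt] at this
  linarith

theorem logBranch_mem_strip {u : ℂ} (hu : ‖u - 1‖ < 1) (k : ℤ) :
    logBranch (2 * k * π) u ∈ strip k := by
  have hre := re_pos_of_norm_sub_one_lt hu
  have hu0 : u ≠ 0 := by
    rintro rfl
    simp at hre
  obtain ⟨h1, h2⟩ := exp_mul_cos_sin_logBranch hu0 k
  have harg := abs_lt.1 (Complex.abs_arg_lt_pi_div_two_iff.2 (Or.inl hre))
  refine ⟨?_, ?_, ?_⟩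
  · rw [exp_lt_two_mul_cos_iff, h1, h2]
    exact (norm_sub_one_lt_one_iff u).1 hu
  · simp only [logBranch, Complex.log_im]
    linarith
  · simp only [logBranch, Complex.log_im]
    linarith

theorem exists_logBranch_eq_of_mem_strip {k : ℤ} {z : ℝ × ℝ} (hz : z ∈ strip k) :
    ∃ u : ℂ, ‖u - 1‖ < 1 ∧ logBranch (2 * k * π) u = z := by
  obtain ⟨hz1, hz2, hz3⟩ := hz
  have hpi := Real.pi_pos
  refine ⟨Complex.exp ⟨z.1, z.2 - 2 * k * π⟩, ?_, ?_⟩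
  · rw [norm_sub_one_lt_one_iff, Complex.exp_re, Complex.exp_im]
    have hc := cos_add_two_int_mul_pi (z.2 - 2 * k * π) k
    have hs := sin_add_two_int_mul_pi (z.2 - 2 * k * π) k
    rw [sub_add_cancel] at hc hs
    simp only []
    rw [← hc, ← hs]
    exact (exp_lt_two_mul_cos_iff _ _).1 hz1
  · rw [logBranch, Complex.log_exp (by simp only []; linarith) (by simp only []; linarith)]
    simp

theorem image_logBranch_ball (k : ℤ) : logBranch (2 * k * π) '' Metric.ball 1 1 = strip k := by
  ext z
  constructor
  · rintro ⟨u, hu, rfl⟩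
    exact logBranch_mem_strip (mem_ball_iff_norm.1 hu) k
  · intro hz
    obtain ⟨u, hu, rfl⟩ := exists_logBranch_eq_of_mem_strip hz
    exact ⟨u, mem_ball_iff_norm.2 hu, rfl⟩

theorem isPreconnected_strip (k : ℤ) : IsPreconnected (strip k) := by
  rw [← image_logBranch_ball]
  refine (convex_ball (1 : ℂ) 1).isPreconnected.image _ ?_
  have hlog : ContinuousOn Complex.log (Metric.ball 1 1) := fun u hu =>
    (continuousAt_clog (Or.inl (re_pos_of_norm_sub_one_lt
      (mem_ball_iff_norm.1 hu)))).continuousWithinAt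
  exact (Complex.continuous_re.comp_continuousOn hlog).prodMk
    ((Complex.continuous_im.comp_continuousOn hlog).add continuousOn_const)

theorem isOpen_strip (k : ℤ) : IsOpen (strip k) := by
  have hx : Continuous fun z : ℝ × ℝ => Real.exp z.1 := by fun_prop
  have hc : Continuous fun z : ℝ × ℝ => 2 * Real.cos z.2 := by fun_prop
  have hy : Continuous fun z : ℝ × ℝ => 2 * z.2 := by fun_prop
  exact (isOpen_lt hx hc).inter
    ((isOpen_lt continuous_const hy).inter (isOpen_lt hy continuous_const))

theorem center_mem_strip (k : ℤ) : ((0 : ℝ), 2 * (k : ℝ) * π) ∈ strip k := by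
  have h := cos_add_two_int_mul_pi 0 k
  rw [zero_add, Real.cos_zero] at h
  have hpi := Real.pi_pos
  refine ⟨?_, ?_, ?_⟩
  · simp only [Real.exp_zero, h]
    norm_num
  · simp only []
    linarith
  · simp only []
    linarith

/-- A boundary point of the strip that is not in it lies on `e^x = 2 cos y`. -/
theorem exp_eq_of_mem_closure_strip {k : ℤ} {z : ℝ × ℝ} (hz : z ∈ closure (strip k))
    (hz' : z ∉ strip k) : Real.exp z.1 = 2 * Real.cos z.2 := by
  have hx : Continuous fun z : ℝ × ℝ => Real.exp z.1 := by fun_prop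
  have hc : Continuous fun z : ℝ × ℝ => 2 * Real.cos z.2 := by fun_prop
  have hy : Continuous fun z : ℝ × ℝ => 2 * z.2 := by fun_prop
  have hclosed : IsClosed {z : ℝ × ℝ | Real.exp z.1 ≤ 2 * Real.cos z.2 ∧
      (4 * k - 1) * Real.pi ≤ 2 * z.2 ∧ 2 * z.2 ≤ (4 * k + 1) * Real.pi} :=
    (isClosed_le hx hc).inter
      ((isClosed_le continuous_const hy).inter (isClosed_le hy continuous_const))
  obtain ⟨h1, h2, h3⟩ := hclosed.closure_subset_iff.2
    (fun w (hw : w ∈ strip k) => ⟨hw.1.le, hw.2.1.le, hw.2.2.le⟩) hz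
  refine h1.eq_of_not_lt fun hlt => hz' ⟨hlt, h2.lt_of_ne fun h => ?_, h3.lt_of_ne fun h => ?_⟩
  · have hy : z.2 = -(π / 2) + 2 * k * π := by linarith
    rw [hy, cos_add_two_int_mul_pi, Real.cos_neg, Real.cos_pi_div_two, mul_zero] at h1
    exact (Real.exp_pos _).not_ge h1
  · have hy : z.2 = π / 2 + 2 * k * π := by linarith
    rw [hy, cos_add_two_int_mul_pi, Real.cos_pi_div_two, mul_zero] at h1
    exact (Real.exp_pos _).not_ge h1

/-- The only singular point in the strip is its center. -/
theorem eq_center_of_singular {k : ℤ} {z : ℝ × ℝ} (hz : z ∈ strip k)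
    (h1 : Real.exp z.1 * Real.sin z.2 = 0)
    (h2 : Real.exp z.1 ^ 2 - Real.exp z.1 * Real.cos z.2 = 0) :
    z = ((0 : ℝ), 2 * (k : ℝ) * π) := by
  obtain ⟨-, hz2, hz3⟩ := hz
  have hpi := Real.pi_pos
  have he := Real.exp_pos z.1
  have hs := sin_add_two_int_mul_pi (z.2 - 2 * k * π) k
  rw [sub_add_cancel, (mul_eq_zero.1 h1).resolve_left he.ne'] at hs
  have hy := (Real.sin_eq_zero_iff_of_lt_of_lt (by linarith) (by linarith)).1 hs.symm
  have hc := cos_add_two_int_mul_pi (z.2 - 2 * k * π) k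
  rw [sub_add_cancel, hy, Real.cos_zero] at hc
  rw [hc] at h2
  have hx : Real.exp z.1 = 1 := by
    apply mul_left_cancel₀ he.ne'
    linarith
  exact Prod.ext (Real.exp_eq_one_iff _ |>.1 hx) (sub_eq_zero.1 hy)

theorem exists_periodic_solution_strip {X : ℝ × ℝ → ℝ × ℝ}
    (hX : ∀ z, X z = (-(Real.exp z.1 * Real.sin z.2),
      Real.exp z.1 ^ 2 - Real.exp z.1 * Real.cos z.2))
    {k : ℤ} {z : ℝ × ℝ} (hz : z ∈ strip k) (hz0 : z ≠ ((0 : ℝ), 2 * (k : ℝ) * π)) :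
    ∃ γ, IsPeriodicSolOn X (strip k) γ ∧ γ 0 = z := by
  obtain ⟨u, hu, hlog⟩ := exists_logBranch_eq_of_mem_strip hz
  obtain ⟨U, hU0, hUn, hUd, T, hT, hper⟩ := exists_periodic_orbit_disc hu
  have hγ0 : logBranch (2 * k * π) (U 0) = z := by rw [hU0, hlog]
  have hd : ∀ t, HasDerivAt (fun t => logBranch (2 * k * π) (U t))
      (X (logBranch (2 * k * π) (U t))) t := by
    intro t
    have hre := re_pos_of_norm_sub_one_lt (hUn t)
    have hne : U t ≠ 0 := fun h => by simp [h] at hre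
    obtain ⟨h1, h2⟩ := exp_mul_cos_sin_logBranch hne k
    have hl := (hUd t).clog_real (Or.inl hre)
    rw [mul_div_cancel_left₀ _ hne] at hl
    have hre' := (Complex.reCLM.hasFDerivAt.comp_hasDerivAt t hl)
    have him' := (Complex.imCLM.hasFDerivAt.comp_hasDerivAt t hl).add_const (2 * k * π)
    have hpair := hre'.prodMk him'
    have hsq : Real.exp (logBranch (2 * k * π) (U t)).1 ^ 2 = (U t).re ^ 2 + (U t).im ^ 2 := by
      rw [← h1, ← h2]
      linear_combination -(Real.exp (logBranch (2 * k * π) (U t)).1 ^ 2) *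
        Real.sin_sq_add_cos_sq (logBranch (2 * k * π) (U t)).2
    rw [hX, h1, h2, hsq]
    refine hpair.congr_deriv ?_
    ext
    · simp
      ring
    · simp
      ring
  refine ⟨fun t => logBranch (2 * k * π) (U t),
    ⟨fun t => logBranch_mem_strip (hUn t) k, hd, ⟨T, hT, fun t => by simp only [hper]⟩, ?_⟩, hγ0⟩
  by_contra! hconst
  have h0 := hd 0
  rw [funext fun t => hconst t 0] at h0
  have hX0 := h0.unique (hasDerivAt_const _ _)
  rw [hγ0, hX] at hX0
  exact hz0 (eq_center_of_singular hz (neg_eq_zero.1 (congrArg Prod.fst hX0))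
    (congrArg Prod.snd hX0))

theorem example_exp_cos_sin_period_annuli (f : ℝ × ℝ → ℝ × ℝ)
    (hf : ∀ x y : ℝ, f (x, y) =
      (Real.exp x * Real.cos y - 1, Real.exp x * Real.sin y))
    (k : ℤ) (P : Set (ℝ × ℝ))
    (hP : P = {z : ℝ × ℝ | Real.exp z.1 < 2 * Real.cos z.2 ∧
      (4 * k - 1) * Real.pi < 2 * z.2 ∧ 2 * z.2 < (4 * k + 1) * Real.pi}) :
    P = {z : ℝ × ℝ |
        (Real.exp z.1 * Real.cos z.2 - 1) ^ 2 + (Real.exp z.1 * Real.sin z.2) ^ 2 < 1 ∧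
        (4 * k - 1) * Real.pi / 2 < z.2 ∧ z.2 < (4 * k + 1) * Real.pi / 2} ∧
      (∀ z ∈ P \ {((0 : ℝ), 2 * (k : ℝ) * Real.pi)},
        ∃ γ, IsPeriodicSolOn (hamVF f) P γ ∧ γ 0 = z) ∧
      IsPeriodAnnulus (hamVF f) Set.univ ((0 : ℝ), 2 * (k : ℝ) * Real.pi) P := by
  have hX := hamVF_exp_sub_one f hf
  obtain rfl : P = strip k := hP
  have hper : ∀ z ∈ strip k \ {((0 : ℝ), 2 * (k : ℝ) * Real.pi)},
      ∃ γ, IsPeriodicSolOn (hamVF f) (strip k) γ ∧ γ 0 = z :=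
    fun z hz => exists_periodic_solution_strip hX hz.1 hz.2
  refine ⟨?_, hper, center_mem_strip k, subset_univ _, isOpen_strip k,
    ⟨⟨_, center_mem_strip k⟩, isPreconnected_strip k⟩, hper, ?_⟩
  · ext z
    refine and_congr (exp_lt_two_mul_cos_iff _ _) (and_congr ?_ ?_)
    · rw [div_lt_iff₀ two_pos, mul_comm z.2]
    · rw [lt_div_iff₀ two_pos, mul_comm z.2]
  · intro W' _ _ _ hconn hW' hsub
    refine Subset.antisymm ?_ hsub
    refine hconn.isPreconnected.subset_of_closure_inter_subset (isOpen_strip k)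
      ⟨_, hsub (center_mem_strip k), center_mem_strip k⟩ ?_
    rintro z ⟨hzc, hzW⟩
    by_contra hz
    have hne : z ≠ ((0 : ℝ), 2 * (k : ℝ) * Real.pi) := by
      rintro rfl
      exact hz (center_mem_strip k)
    obtain ⟨γ, ⟨-, hd, ⟨T, hT, hγT⟩, -⟩, rfl⟩ := hW' z ⟨hzW, hne⟩
    exact not_periodic_of_exp_eq (fun t => hX (γ t) ▸ hd t)
      (exp_eq_of_mem_closure_strip hzc hz) hT (hγT 0)
end

section
/- Let f = (f₁, f₂) : ℝ² → ℝ² be defined by f₁(x,y) = e^x cos y − 1 and f₂(x,y) = e^x sin y. Then for every h > 1/2, the level set H_f^{-1}{h} = {(x,y) ∈ ℝ² : (e^x cos y − 1)² + (e^x sin y)² = 2h} is connected. -/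
open Real Set

/-- For `c > 0`, the equation `u² - 2 a u = c` has exactly one positive solution. -/
lemma pos_and_sq_sub_eq_iff {a c u : ℝ} (hc : 0 < c) :
    (0 < u ∧ u ^ 2 - 2 * a * u = c) ↔ u = a + √(a ^ 2 + c) := by
  have hs : √(a ^ 2 + c) ^ 2 = a ^ 2 + c := Real.sq_sqrt (by positivity)
  have habs : |a| < √(a ^ 2 + c) := Real.lt_sqrt_of_sq_lt (by rw [sq_abs]; linarith)
  obtain ⟨h₁, h₂⟩ := abs_lt.mp habs
  constructor
  · rintro ⟨hu, he⟩
    have hprod : (u - (a + √(a ^ 2 + c))) * (u - a + √(a ^ 2 + c)) = 0 := by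
      linear_combination he - hs
    rcases mul_eq_zero.mp hprod with h | h <;> linarith
  · rintro rfl
    exact ⟨by linarith, by linear_combination hs⟩

theorem example_exp_cos_sin_high_level_sets_connected (f : ℝ × ℝ → ℝ × ℝ)
    (hf : ∀ x y : ℝ, f (x, y) =
      (Real.exp x * Real.cos y - 1, Real.exp x * Real.sin y)) :
    ∀ h : ℝ, 1 / 2 < h →
      IsConnected {z : ℝ × ℝ |
        (Real.exp z.1 * Real.cos z.2 - 1) ^ 2
          + (Real.exp z.1 * Real.sin z.2) ^ 2 = 2 * h} := by
  intro h hh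
  have hc : 0 < 2 * h - 1 := by linarith
  have hpos : ∀ y : ℝ, 0 < Real.cos y + √(Real.cos y ^ 2 + (2 * h - 1)) := fun y =>
    ((pos_and_sq_sub_eq_iff hc).mpr rfl).1
  have hgraph : {z : ℝ × ℝ | (Real.exp z.1 * Real.cos z.2 - 1) ^ 2
      + (Real.exp z.1 * Real.sin z.2) ^ 2 = 2 * h} =
      Set.range fun y : ℝ =>
        (Real.log (Real.cos y + √(Real.cos y ^ 2 + (2 * h - 1))), y) := by
    ext ⟨x, y⟩
    have hxy : (Real.exp x * Real.cos y - 1) ^ 2 + (Real.exp x * Real.sin y) ^ 2 =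
        Real.exp x ^ 2 - 2 * Real.cos y * Real.exp x + 1 := by
      linear_combination Real.exp x ^ 2 * Real.sin_sq_add_cos_sq y
    simp only [Set.mem_ofPred_eq, Set.mem_range, Prod.mk.injEq, hxy]
    constructor
    · intro he
      refine ⟨y, ?_, rfl⟩
      rw [← (pos_and_sq_sub_eq_iff hc).mp ⟨Real.exp_pos x, by linarith⟩, Real.log_exp]
    · rintro ⟨y, rfl, rfl⟩
      rw [Real.exp_log (hpos y)]
      linarith [((pos_and_sq_sub_eq_iff hc).mpr (rfl :
        Real.cos y + √(Real.cos y ^ 2 + (2 * h - 1)) = _)).2]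
  rw [hgraph]
  refine isConnected_range (Continuous.prodMk (Continuous.log ?_ fun y => (hpos y).ne')
    continuous_id)
  fun_prop
end
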